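/- Let p be a prime, t a positive integer, n ≥ 2, and define e(i) = p^{t·⌈log_p(n/i)⌉} for 1 ≤ i ≤ n. Then I_e consists exactly of the integers of the form ⌈n/p^k⌉ for k ≥ 0. -/

import Mathlib

theorem Nat.add_sub_one_div_le_iff {n q m : ℕ} (hq : 0 < q) :
    (n + q - 1) / q ≤ m ↔ n ≤ m * q := by
  rw [← Nat.ceilDiv_eq_add_pred_div, ceilDiv_le_iff_le_mul hq, mul_comm]

/-- Let `p` be a prime, `t ≥ 1`, `n ≥ 2`, and let `e i = p ^ (t * j i)` where
`j i = ⌈log_p (n / i)⌉` (characterized for `1 ≤ i ≤ n` as the least `k` with `n ≤ i * p ^ k`).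
Then `I_e` consists exactly of the integers of the form `⌈n / p ^ k⌉`, `k ≥ 0`:
for `1 ≤ i ≤ n`, one has `i' · e i' ≥ i · e i` for all `1 ≤ i' ≤ i` if and only if
`i = ⌈n / p ^ k⌉` for some `k`. -/
theorem stmt_2 (p t n : ℕ) (hp : p.Prime) (ht : 1 ≤ t) (hn : 2 ≤ n)
    (j : ℕ → ℕ)
    (hj : ∀ i, 1 ≤ i → i ≤ n → (n ≤ i * p ^ j i ∧ ∀ k, k < j i → ¬ n ≤ i * p ^ k)) :
    ∀ i, 1 ≤ i → i ≤ n →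
      ((∀ i', 1 ≤ i' → i' ≤ i → i * p ^ (t * j i) ≤ i' * p ^ (t * j i'))
        ↔ ∃ k : ℕ, i = (n + p ^ k - 1) / p ^ k) := by
  intro i hi hin
  have hpos (k : ℕ) : 0 < p ^ k := pow_pos hp.pos k
  have j_le {a k : ℕ} (ha : 1 ≤ a) (han : a ≤ n) (h : n ≤ a * p ^ k) : j a ≤ k :=
    not_lt.1 fun hlt => (hj a ha han).2 k hlt h
  obtain ⟨hn_le, -⟩ := hj i hi hin
  constructor
  · intro h
    refine ⟨j i, le_antisymm ?_ ((Nat.add_sub_one_div_le_iff (hpos _)).2 hn_le)⟩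
    set c := (n + p ^ j i - 1) / p ^ j i with hc
    have hn_c : n ≤ c * p ^ j i := (Nat.add_sub_one_div_le_iff (hpos _)).1 hc.ge
    have hci : c ≤ i := (Nat.add_sub_one_div_le_iff (hpos _)).2 hn_le
    have hc1 : 1 ≤ c := by
      by_contra! hlt
      rw [Nat.lt_one_iff.1 hlt] at hn_c
      omega
    have hjc : j c ≤ j i := j_le hc1 (hci.trans hin) hn_c
    refine Nat.le_of_mul_le_mul_right ((h c hc1 hci).trans ?_) (hpos (t * j i))
    gcongr
    exact hp.one_le
  · rintro ⟨k, hk⟩ i' hi' hii'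
    obtain rfl | hlt := hii'.eq_or_lt
    · rfl
    have hnk : n ≤ i * p ^ k := (Nat.add_sub_one_div_le_iff (hpos _)).1 hk.ge
    have hjk : j i ≤ k := j_le hi hin hnk
    have hmin {m : ℕ} (hm : n ≤ m * p ^ j i) : i ≤ m := by
      rw [hk]
      refine (Nat.add_sub_one_div_le_iff (hpos _)).2 (hm.trans ?_)
      gcongr
      exact hp.one_le
    obtain ⟨hn_le', -⟩ := hj i' hi' (hii'.trans hin)
    have hjj : j i ≤ j i' := by
      by_contra! hji
      refine hlt.not_ge (hmin (hn_le'.trans ?_))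
      gcongr
      exact hp.one_le
    obtain ⟨s, hs⟩ := Nat.exists_eq_add_of_le hjj
    have his : i ≤ i' * p ^ s := hmin (by rwa [mul_assoc, ← pow_add, add_comm s, ← hs])
    calc i * p ^ (t * j i) ≤ i' * p ^ (t * s) * p ^ (t * j i) := by
          refine Nat.mul_le_mul_right _ (his.trans (Nat.mul_le_mul_left _ ?_))
          exact Nat.pow_le_pow_right hp.pos (Nat.le_mul_of_pos_left s ht)
      _ = i' * p ^ (t * j i') := by rw [hs, mul_assoc, ← pow_add, mul_add, add_comm]
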